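/- Let 1 < p < ∞, let μ be a positive Borel measure on ℝ, and let f be a nonnegative μ-measurable function on ℝ with μ({f > t}) < ∞ for all t > 0. Then ‖M_μ f‖_{L^{p,∞}(ℝ,dμ)} ≤ ‖M(f*)‖_{L^{p,∞}(ℝ,dx)}, where the right-hand quasinorm is taken with respect to Lebesgue measure, M_μ is the uncentered maximal operator with respect to μ, M is the uncentered maximal operator with respect to Lebesgue measure, and f* is the symmetric decreasing rearrangement of f with respect to μ. -/

import Mathlib

open MeasureTheory Set ENNReal

/-- Symmetric decreasing rearrangement (w.r.t. the measure `μ`) of an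
`ℝ≥0∞`-valued function `g` on `ℝ`:  `g*(x) = inf {t > 0 | μ {g > t} ≤ 2|x|}`. -/
noncomputable def rearrE (μ : Measure ℝ) (g : ℝ → ℝ≥0∞) (x : ℝ) : ℝ≥0∞ :=
  sInf {t : ℝ≥0∞ | 0 < t ∧ μ {y | t < g y} ≤ ENNReal.ofReal (2 * |x|)}

/-- Symmetric decreasing rearrangement (w.r.t. `μ`) of a real-valued function:
`f*(x) = inf {t > 0 | μ {|f| > t} ≤ 2|x|}`. -/
noncomputable def rearr (μ : Measure ℝ) (f : ℝ → ℝ) (x : ℝ) : ℝ≥0∞ :=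
  rearrE μ (fun y => ENNReal.ofReal |f y|) x

/-- Uncentered Hardy-Littlewood maximal function w.r.t. `μ` of an
`ℝ≥0∞`-valued function: the sup of averages over open intervals containing `x`
of positive `μ`-measure. -/
noncomputable def maximalE (μ : Measure ℝ) (g : ℝ → ℝ≥0∞) (x : ℝ) : ℝ≥0∞ :=
  ⨆ (a : ℝ) (b : ℝ) (_ : x ∈ Ioo a b) (_ : 0 < μ (Ioo a b)),
    (μ (Ioo a b))⁻¹ * ∫⁻ y in Ioo a b, g y ∂μ

/-- Uncentered Hardy-Littlewood maximal function `M_μ f` of a real-valued `f`. -/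
noncomputable def maximal (μ : Measure ℝ) (f : ℝ → ℝ) (x : ℝ) : ℝ≥0∞ :=
  maximalE μ (fun y => ENNReal.ofReal |f y|) x

/-- Weak `L^p` quasinorm w.r.t. `μ` of an `ℝ≥0∞`-valued function:
`sup_{t>0} t · μ({g > t})^(1/p)`. -/
noncomputable def wnormE (μ : Measure ℝ) (g : ℝ → ℝ≥0∞) (p : ℝ) : ℝ≥0∞ :=
  ⨆ (t : ℝ) (_ : 0 < t), ENNReal.ofReal t * μ {x | ENNReal.ofReal t < g x} ^ (1 / p)

/-- Weak `L^p` quasinorm `‖f‖_{L^{p,∞}(ℝ,dμ)} = sup_{t>0} t · μ({|f| > t})^(1/p)`. -/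
noncomputable def wnorm' (μ : Measure ℝ) (f : ℝ → ℝ) (p : ℝ) : ℝ≥0∞ :=
  wnormE μ (fun x => ENNReal.ofReal |f x|) p

/-- `f` is distributionally symmetric: for every `t > 0` the sets
`{x > 0 | f x > t}` and `{x < 0 | f x > t}` have the same Lebesgue measure. -/
def DistribSymm (f : ℝ → ℝ) : Prop :=
  ∀ t : ℝ, 0 < t → volume {x | 0 < x ∧ t < f x} = volume {x | x < 0 ∧ t < f x}

/-- Every finite family of open intervals has a subfamily with the same union in which no point
is covered more than twice. -/
lemma exists_subset_biUnion_Ioo_card_le_two (S : Finset (ℝ × ℝ)) :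
    ∃ T ⊆ S, (⋃ q ∈ T, Ioo q.1 q.2) = (⋃ q ∈ S, Ioo q.1 q.2) ∧
      ∀ x, (T.filter fun q => x ∈ Ioo q.1 q.2).card ≤ 2 := by
  classical
  induction S using Finset.strongInduction with
  | H S ih =>
    by_cases h : ∀ x, (S.filter fun q => x ∈ Ioo q.1 q.2).card ≤ 2
    · exact ⟨S, subset_rfl, rfl, h⟩
    push Not at h
    obtain ⟨x, hx⟩ := h
    have hne : (S.filter fun q => x ∈ Ioo q.1 q.2).Nonempty := Finset.card_pos.1 (by omega)
    obtain ⟨l, hl, hlmin⟩ := Finset.exists_min_image _ (fun q : ℝ × ℝ => q.1) hne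
    obtain ⟨u, hu, humax⟩ := Finset.exists_max_image _ (fun q : ℝ × ℝ => q.2) hne
    obtain ⟨v, hv, hvn⟩ : ∃ v ∈ S.filter (fun q => x ∈ Ioo q.1 q.2), v ∉ ({l, u} : Finset _) :=
      Finset.exists_mem_notMem_of_card_lt_card (lt_of_le_of_lt Finset.card_le_two hx)
    have hlv := hlmin v hv
    have huv := humax v hv
    simp only [Finset.mem_filter, mem_Ioo] at hl hu hv
    simp only [Finset.mem_insert, Finset.mem_singleton, not_or] at hvn
    obtain ⟨T, hTS, hTU, hT⟩ := ih (S.erase v) (Finset.erase_ssubset hv.1)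
    refine ⟨T, hTS.trans (Finset.erase_subset _ _), ?_, hT⟩
    rw [hTU]
    apply Subset.antisymm
    · exact biUnion_subset_biUnion_left fun q hq => Finset.mem_of_mem_erase hq
    · intro y hy
      simp only [mem_iUnion, mem_Ioo, exists_prop] at hy ⊢
      obtain ⟨q, hq, hyq⟩ := hy
      by_cases hqv : q = v
      · subst hqv
        rcases le_total y x with hyx | hyx
        · exact ⟨l, Finset.mem_erase.2 ⟨Ne.symm hvn.1, hl.1⟩, by linarith, by linarith⟩
        · exact ⟨u, Finset.mem_erase.2 ⟨Ne.symm hvn.2, hu.1⟩, by linarith, by linarith⟩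
      · exact ⟨q, Finset.mem_erase.2 ⟨hqv, hq⟩, hyq⟩

/-- The two-sided covering inequality behind the sharp weak-type bound: if `g` has average at least
`c` on every interval of a finite family with union `U`, then
`c μ(U) ≤ ∫_U g + ∫ (g - c)₊`. -/
lemma mul_measure_biUnion_le_lintegral_add (μ : Measure ℝ) {g : ℝ → ℝ≥0∞} (hg : Measurable g)
    (c : ℝ≥0∞) (S : Finset (ℝ × ℝ))
    (hS : ∀ q ∈ S, c * μ (Ioo q.1 q.2) ≤ ∫⁻ y in Ioo q.1 q.2, g y ∂μ) :
    c * μ (⋃ q ∈ S, Ioo q.1 q.2) ≤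
      (∫⁻ y in ⋃ q ∈ S, Ioo q.1 q.2, g y ∂μ) + ∫⁻ y, (g y - c) ∂μ := by
  classical
  obtain ⟨T, hTS, hTU, hT⟩ := exists_subset_biUnion_Ioo_card_le_two S
  rw [← hTU]
  set U := ⋃ q ∈ T, Ioo q.1 q.2 with hU
  have hUm : MeasurableSet U := Finset.measurableSet_biUnion _ fun _ _ => measurableSet_Ioo
  let N : ℝ → ℕ := fun y => (T.filter fun q => y ∈ Ioo q.1 q.2).card
  have hsum : ∀ (w : ℝ → ℝ≥0∞) (y : ℝ),
      (∑ q ∈ T, (Ioo q.1 q.2).indicator w y) = N y * w y := by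
    intro w y
    simp only [N, indicator_apply, ← Finset.sum_filter, Finset.sum_const, nsmul_eq_mul]
  have hNU : ∀ y, y ∉ U → N y = 0 := by
    intro y hy
    simp only [hU, mem_iUnion, not_exists] at hy
    simp only [N, Finset.card_eq_zero, Finset.filter_eq_empty_iff]
    exact fun q hq => hy q hq
  have hUN : ∀ y, y ∈ U → N y = 1 ∨ N y = 2 := by
    intro y hy
    simp only [hU, mem_iUnion] at hy
    obtain ⟨q, hq, hyq⟩ := hy
    have h1 : 0 < N y := Finset.card_pos.2 ⟨q, Finset.mem_filter.2 ⟨hq, hyq⟩⟩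
    have h2 : N y ≤ 2 := hT y
    omega
  have hint : ∀ w : ℝ → ℝ≥0∞, Measurable w →
      (∫⁻ y, N y * w y ∂μ) = ∑ q ∈ T, ∫⁻ y in Ioo q.1 q.2, w y ∂μ := by
    intro w hw
    simp only [← hsum]
    rw [lintegral_finsetSum _ fun q _ => hw.indicator measurableSet_Ioo]
    exact Finset.sum_congr rfl fun q _ => lintegral_indicator measurableSet_Ioo _
  have hNm : ∀ w : ℝ → ℝ≥0∞, Measurable w → Measurable fun y => (N y : ℝ≥0∞) * w y := by
    intro w hw
    simp only [← hsum]
    exact Finset.measurable_sum _ fun q _ => hw.indicator measurableSet_Ioo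
  have hle : (∫⁻ y, N y * c ∂μ) ≤ ∫⁻ y, N y * g y ∂μ := by
    rw [hint _ measurable_const, hint _ hg]
    refine Finset.sum_le_sum fun q hq => ?_
    rw [setLIntegral_const]
    exact hS q (hTS hq)
  have hpt : ∀ y, N y * g y + U.indicator (fun _ => c) y ≤
      N y * c + (U.indicator g y + (g y - c)) := by
    intro y
    by_cases hy : y ∈ U
    · rw [indicator_of_mem hy, indicator_of_mem hy]
      rcases hUN y hy with h | h
      · rw [h, Nat.cast_one, one_mul, one_mul, add_comm (g y) c, ← add_assoc]
        exact le_self_add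
      · have : g y ≤ c + (g y - c) := le_add_tsub
        rw [h, Nat.cast_two, two_mul, two_mul]
        calc g y + g y + c = g y + c + g y := by ring
          _ ≤ g y + c + (c + (g y - c)) := by gcongr
          _ = _ := by ring
    · simp [hy, hNU y hy]
  have hmain : (∫⁻ y, N y * g y ∂μ) + c * μ U ≤
      (∫⁻ y, N y * g y ∂μ) + ((∫⁻ y in U, g y ∂μ) + ∫⁻ y, (g y - c) ∂μ) := by
    calc (∫⁻ y, N y * g y ∂μ) + c * μ U
        = ∫⁻ y, (N y * g y + U.indicator (fun _ => c) y) ∂μ := by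
          rw [lintegral_add_left (hNm _ hg), lintegral_indicator_const hUm]
      _ ≤ ∫⁻ y, (N y * c + (U.indicator g y + (g y - c))) ∂μ := lintegral_mono hpt
      _ = (∫⁻ y, N y * c ∂μ) + ((∫⁻ y in U, g y ∂μ) + ∫⁻ y, (g y - c) ∂μ) := by
          rw [lintegral_add_left (hNm _ measurable_const),
            lintegral_add_left (hg.indicator hUm), lintegral_indicator hUm]
      _ ≤ _ := by gcongr
  by_cases htop : (∫⁻ y, N y * g y ∂μ) = ∞
  · have h2 : (∫⁻ y, N y * g y ∂μ) ≤ 2 * ∫⁻ y in U, g y ∂μ := by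
      rw [← lintegral_indicator hUm, ← lintegral_const_mul _ (hg.indicator hUm)]
      refine lintegral_mono fun y => ?_
      by_cases hy : y ∈ U
      · rw [indicator_of_mem hy]
        gcongr
        exact_mod_cast hT y
      · simp [hy, hNU y hy]
    rw [htop, top_le_iff, ENNReal.mul_eq_top] at h2
    have h3 : (∫⁻ y in U, g y ∂μ) = ∞ := by simpa using h2
    simp [h3]
  · exact (ENNReal.add_le_add_iff_left htop).1 hmain

/-- The layer-cake formula bounds the integral of the rearrangement over an interval around the
origin from below. -/
lemma lintegral_min_add_le_lintegral_rearrE (μ : Measure ℝ) (f : ℝ → ℝ)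
    (hfin : ∀ t : ℝ, 0 < t → μ {x | t < f x} < ⊤) {a b : ℝ} (ha : 0 ≤ a) (hb : 0 ≤ b) :
    (∫⁻ t in Ioi (0 : ℝ), min (ENNReal.ofReal (2 * a)) (μ {x | t < f x})) +
      (∫⁻ t in Ioi (0 : ℝ), min (ENNReal.ofReal (2 * b)) (μ {x | t < f x})) ≤
      2 * ∫⁻ x in Ioo (-a) b, rearrE μ (fun y => ENNReal.ofReal (f y)) x := by
  set D : ℝ → ℝ≥0∞ := fun t => μ {x | t < f x} with hD
  have hDanti : Antitone D := fun s t hst => measure_mono fun x (hx : t < f x) => hst.trans_lt hx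
  have hDm : Measurable D := hDanti.measurable
  let A : Set (ℝ × ℝ) := {z | ENNReal.ofReal (2 * |z.1|) < D z.2}
  have hA : MeasurableSet A :=
    measurableSet_lt (by fun_prop) (hDm.comp measurable_snd)
  have hlow : ∀ x : ℝ, (∫⁻ t in Ioi (0 : ℝ), A.indicator 1 (x, t)) ≤
      rearrE μ (fun y => ENNReal.ofReal (f y)) x := by
    intro x
    refine le_sInf ?_
    rintro τ ⟨-, hτ⟩
    by_cases hτt : τ = ∞
    · simp [hτt]
    have hsub : ∀ t ∈ Ioi (0 : ℝ),
        A.indicator (1 : ℝ × ℝ → ℝ≥0∞) (x, t) ≤ (Ioc 0 τ.toReal).indicator 1 t := by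
      intro t ht
      by_cases hz : (x, t) ∈ A
      · rw [indicator_of_mem hz, indicator_of_mem]
        · rfl
        refine ⟨ht, ?_⟩
        by_contra! hlt
        have h1 : D t ≤ ENNReal.ofReal (2 * |x|) := by
          refine le_trans (measure_mono fun y (hy : t < f y) => ?_) hτ
          change τ < ENNReal.ofReal (f y)
          exact (ENNReal.lt_ofReal_iff_toReal_lt hτt).2 (hlt.trans hy)
        exact absurd hz (not_lt.2 h1)
      · simp [hz]
    calc (∫⁻ t in Ioi (0 : ℝ), A.indicator 1 (x, t))
        ≤ ∫⁻ t in Ioi (0 : ℝ), (Ioc 0 τ.toReal).indicator 1 t :=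
          setLIntegral_mono' measurableSet_Ioi hsub
      _ ≤ ∫⁻ t, (Ioc 0 τ.toReal).indicator 1 t := setLIntegral_le_lintegral _ _
      _ = τ := by
          rw [lintegral_indicator_one measurableSet_Ioc, Real.volume_Ioc, sub_zero,
            ENNReal.ofReal_toReal hτt]
  have hslice : ∀ t ∈ Ioi (0 : ℝ),
      min (ENNReal.ofReal (2 * a)) (D t) + min (ENNReal.ofReal (2 * b)) (D t) ≤
        2 * ∫⁻ x in Ioo (-a) b, A.indicator 1 (x, t) := by
    intro t ht
    obtain ⟨e, he, hDe⟩ : ∃ e : ℝ, 0 ≤ e ∧ D t = ENNReal.ofReal (2 * e) :=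
      ⟨(D t).toReal / 2, by positivity, by
        rw [mul_div_cancel₀ _ two_ne_zero, ENNReal.ofReal_toReal (hfin t ht).ne]⟩
    have hI : (Ioo (-(min a e)) (min b e)).indicator (1 : ℝ → ℝ≥0∞) ≤
        (Ioo (-a) b).indicator fun x => A.indicator 1 (x, t) := by
      refine indicator_le fun x hx => ?_
      obtain ⟨h1, h2⟩ := hx
      rw [neg_lt, lt_min_iff] at h1
      rw [lt_min_iff] at h2
      have hxe : |x| < e := abs_lt.2 ⟨by linarith, h2.2⟩
      have hxA : (x, t) ∈ A := by
        change ENNReal.ofReal (2 * |x|) < D t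
        rw [hDe, ENNReal.ofReal_lt_ofReal_iff_of_nonneg (by positivity)]
        linarith
      rw [indicator_of_mem (show x ∈ Ioo (-a) b from ⟨by linarith, h2.1⟩), indicator_of_mem hxA]
      rfl
    have hvol := lintegral_mono (μ := volume) hI
    rw [lintegral_indicator_one measurableSet_Ioo, Real.volume_Ioo,
      lintegral_indicator measurableSet_Ioo] at hvol
    refine le_trans (le_of_eq ?_) (mul_le_mul_right hvol 2)
    have hae : 0 ≤ min a e := le_min ha he
    have hbe : 0 ≤ min b e := le_min hb he
    rw [hDe, ← ENNReal.ofReal_min, ← ENNReal.ofReal_min, ← mul_min_of_nonneg _ _ zero_le_two,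
      ← mul_min_of_nonneg _ _ zero_le_two, ← ENNReal.ofReal_add (by positivity) (by positivity),
      ← ENNReal.ofReal_ofNat 2, ← ENNReal.ofReal_mul zero_le_two]
    congr 1
    ring
  have hAm : Measurable (A.indicator (1 : ℝ × ℝ → ℝ≥0∞)) := measurable_one.indicator hA
  rw [← lintegral_add_left (measurable_const.min hDm)]
  calc (∫⁻ t in Ioi (0 : ℝ), (min (ENNReal.ofReal (2 * a)) (D t) +
        min (ENNReal.ofReal (2 * b)) (D t)))
      ≤ ∫⁻ t in Ioi (0 : ℝ), 2 * ∫⁻ x in Ioo (-a) b, A.indicator 1 (x, t) :=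
        setLIntegral_mono' measurableSet_Ioi hslice
    _ = 2 * ∫⁻ t in Ioi (0 : ℝ), ∫⁻ x in Ioo (-a) b, A.indicator 1 (x, t) :=
        lintegral_const_mul' _ _ (by simp)
    _ = 2 * ∫⁻ x in Ioo (-a) b, ∫⁻ t in Ioi (0 : ℝ), A.indicator 1 (x, t) := by
        rw [lintegral_lintegral_swap]
        exact (hAm.comp measurable_swap).aemeasurable
    _ ≤ _ := by
        gcongr with x
        exact hlow x

/-- If `g = f₊` has average at least `c` on each interval of a finite family with union of measure
`2 r`, and `μ {f > c} = 2 s`, then `c (r + s)` is at most half of the sum of the truncated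
layer-cake integrals. -/
lemma ofReal_mul_add_le_lintegral_min (μ : Measure ℝ) {f : ℝ → ℝ} (hf : Measurable f)
    (hf0 : ∀ x, 0 ≤ f x) {c : ℝ} (hc : 0 < c) (S : Finset (ℝ × ℝ))
    (hS : ∀ q ∈ S, ENNReal.ofReal c * μ (Ioo q.1 q.2) ≤
      ∫⁻ y in Ioo q.1 q.2, ENNReal.ofReal (f y) ∂μ) :
    ENNReal.ofReal c * (μ {x | c < f x} + μ (⋃ q ∈ S, Ioo q.1 q.2)) ≤
      (∫⁻ t in Ioi (0 : ℝ), min (μ {x | c < f x}) (μ {x | t < f x})) +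
      (∫⁻ t in Ioi (0 : ℝ), min (μ (⋃ q ∈ S, Ioo q.1 q.2)) (μ {x | t < f x})) := by
  set U := ⋃ q ∈ S, Ioo q.1 q.2 with hU
  set D : ℝ → ℝ≥0∞ := fun t => μ {x | t < f x} with hD
  have hDanti : Antitone D := fun s t hst => measure_mono fun x (hx : t < f x) => hst.trans_lt hx
  have hcov := mul_measure_biUnion_le_lintegral_add μ hf.ennreal_ofReal (ENNReal.ofReal c) S hS
  have hUint : (∫⁻ y in U, ENNReal.ofReal (f y) ∂μ) ≤ ∫⁻ t in Ioi (0 : ℝ), min (μ U) (D t) := by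
    rw [lintegral_eq_lintegral_meas_lt _ (.of_forall hf0) hf.aemeasurable]
    gcongr with t
    exact le_min ((measure_mono (subset_univ _)).trans_eq (Measure.restrict_apply_univ U))
      (Measure.restrict_apply_le _ _)
  have htail : (∫⁻ y, (ENNReal.ofReal (f y) - ENNReal.ofReal c) ∂μ) = ∫⁻ t in Ioi c, D t := by
    have h1 : ∀ y, ENNReal.ofReal (f y) - ENNReal.ofReal c = ENNReal.ofReal (max (f y - c) 0) := by
      intro y
      rw [← ENNReal.ofReal_sub _ hc.le, ENNReal.ofReal_max, ENNReal.ofReal_zero, max_eq_left]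
      exact zero_le
    simp only [h1]
    rw [lintegral_eq_lintegral_meas_lt (f := fun y => max (f y - c) 0) _
      (.of_forall fun y => le_max_right _ _)
      ((hf.sub_const c).max measurable_const).aemeasurable]
    have h2 : ∀ t ∈ Ioi (0 : ℝ), μ {y | t < max (f y - c) 0} = D (t + c) := by
      intro t ht
      simp only [hD, lt_max_iff, not_lt.2 (le_of_lt (mem_Ioi.1 ht)), or_false, lt_sub_iff_add_lt]
    rw [setLIntegral_congr_fun measurableSet_Ioi h2, ← lintegral_indicator measurableSet_Ioi,
      ← lintegral_indicator measurableSet_Ioi,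
      ← lintegral_add_right_eq_self ((Ioi c).indicator D) c]
    refine lintegral_congr fun t => ?_
    simp [indicator_apply]
  have hsplit : ENNReal.ofReal c * D c + (∫⁻ t in Ioi c, D t) ≤
      ∫⁻ t in Ioi (0 : ℝ), min (D c) (D t) := by
    rw [← Ioc_union_Ioi_eq_Ioi hc.le,
      lintegral_union measurableSet_Ioi Ioc_disjoint_Ioi_same]
    gcongr ?_ + ?_
    · calc ENNReal.ofReal c * D c = ∫⁻ _ in Ioc 0 c, D c := by
            rw [setLIntegral_const, Real.volume_Ioc, sub_zero, mul_comm]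
        _ ≤ _ := setLIntegral_mono' measurableSet_Ioc fun t ht => le_min le_rfl (hDanti ht.2)
    · exact setLIntegral_mono' measurableSet_Ioi fun t ht => le_min (hDanti (le_of_lt ht)) le_rfl
  calc ENNReal.ofReal c * (D c + μ U)
      = ENNReal.ofReal c * D c + ENNReal.ofReal c * μ U := mul_add _ _ _
    _ ≤ ENNReal.ofReal c * D c + ((∫⁻ y in U, ENNReal.ofReal (f y) ∂μ) + ∫⁻ t in Ioi c, D t) := by
        rw [← htail]
        gcongr
    _ = (ENNReal.ofReal c * D c + ∫⁻ t in Ioi c, D t) +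
          ∫⁻ y in U, ENNReal.ofReal (f y) ∂μ := by ring
    _ ≤ _ := add_le_add hsplit hUint

lemma le_maximalE_of_mul_le (μ : Measure ℝ) (g : ℝ → ℝ≥0∞) {a b x : ℝ} (hx : x ∈ Ioo a b)
    (hpos : 0 < μ (Ioo a b)) (hfin : μ (Ioo a b) ≠ ∞) {c : ℝ≥0∞}
    (h : c * μ (Ioo a b) ≤ ∫⁻ y in Ioo a b, g y ∂μ) : c ≤ maximalE μ g x := by
  refine le_trans ?_ (le_iSup₂_of_le a b (le_iSup₂_of_le hx hpos le_rfl))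
  rw [mul_comm, ← div_eq_mul_inv]
  exact (ENNReal.le_div_iff_mul_le (.inl hpos.ne') (.inl hfin)).2 h

/-- A finite union of intervals on which `f` has average at least `c` has measure at most the
Lebesgue measure of any strict superlevel set of `M(f*)` at a height below `c`. -/
lemma measure_biUnion_le_volume_maximalE_rearrE (μ : Measure ℝ) {f : ℝ → ℝ} (hf : Measurable f)
    (hf0 : ∀ x, 0 ≤ f x) (hfin : ∀ t : ℝ, 0 < t → μ {x | t < f x} < ⊤) {c : ℝ} (hc : 0 < c)
    (S : Finset (ℝ × ℝ)) (hSfin : ∀ q ∈ S, μ (Ioo q.1 q.2) ≠ ∞)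
    (hS : ∀ q ∈ S, ENNReal.ofReal c * μ (Ioo q.1 q.2) ≤
      ∫⁻ y in Ioo q.1 q.2, ENNReal.ofReal (f y) ∂μ) :
    μ (⋃ q ∈ S, Ioo q.1 q.2) ≤
      volume {x | ENNReal.ofReal c ≤
        maximalE volume (rearrE μ fun y => ENNReal.ofReal (f y)) x} := by
  have hkey := ofReal_mul_add_le_lintegral_min μ hf hf0 hc S hS
  have hUfin : μ (⋃ q ∈ S, Ioo q.1 q.2) ≠ ∞ :=
    (measure_biUnion_lt_top S.finite_toSet fun q hq => (hSfin q hq).lt_top).ne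
  obtain ⟨r, hr, hUr⟩ : ∃ r : ℝ, 0 ≤ r ∧ μ (⋃ q ∈ S, Ioo q.1 q.2) = ENNReal.ofReal (2 * r) :=
    ⟨(μ (⋃ q ∈ S, Ioo q.1 q.2)).toReal / 2, by positivity, by
      rw [mul_div_cancel₀ _ two_ne_zero, ENNReal.ofReal_toReal hUfin]⟩
  obtain ⟨s, hs, hDs⟩ : ∃ s : ℝ, 0 ≤ s ∧ μ {x | c < f x} = ENNReal.ofReal (2 * s) :=
    ⟨(μ {x | c < f x}).toReal / 2, by positivity, by
      rw [mul_div_cancel₀ _ two_ne_zero, ENNReal.ofReal_toReal (hfin c hc).ne]⟩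
  rw [hUr, hDs] at hkey
  rw [hUr]
  set F := rearrE μ fun y => ENNReal.ofReal (f y) with hF
  have havg : ∀ a b : ℝ, 0 ≤ a → 0 ≤ b →
      ENNReal.ofReal c * (ENNReal.ofReal (2 * a) + ENNReal.ofReal (2 * b)) ≤
        (∫⁻ t in Ioi (0 : ℝ), min (ENNReal.ofReal (2 * a)) (μ {x | t < f x})) +
        (∫⁻ t in Ioi (0 : ℝ), min (ENNReal.ofReal (2 * b)) (μ {x | t < f x})) →
      ENNReal.ofReal c * volume (Ioo (-a) b) ≤ ∫⁻ x in Ioo (-a) b, F x := by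
    intro a b ha hb h
    have h2 := h.trans (lintegral_min_add_le_lintegral_rearrE μ f hfin ha hb)
    refine (ENNReal.mul_le_mul_iff_right two_ne_zero ENNReal.ofNat_ne_top).1
      (le_trans (le_of_eq ?_) h2)
    rw [Real.volume_Ioo, ← ENNReal.ofReal_add (by positivity) (by positivity),
      mul_left_comm, ← ENNReal.ofReal_ofNat 2, ← ENNReal.ofReal_mul zero_le_two]
    congr 2
    ring
  have hright := havg s r hs hr hkey
  have hleft := havg r s hr hs (by rwa [add_comm (ENNReal.ofReal _), add_comm (lintegral _ _)])
  have hsub : Ioo (-r) 0 ∪ Ioo 0 r ⊆ {x | ENNReal.ofReal c ≤ maximalE volume F x} := by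
    rintro x (⟨h1, h2⟩ | ⟨h1, h2⟩)
    · exact le_maximalE_of_mul_le _ _ (show x ∈ Ioo (-r) s from ⟨h1, by linarith⟩)
        (by rw [Real.volume_Ioo]; exact ENNReal.ofReal_pos.2 (by linarith)) (by simp) hleft
    · exact le_maximalE_of_mul_le _ _ (show x ∈ Ioo (-s) r from ⟨by linarith, h2⟩)
        (by rw [Real.volume_Ioo]; exact ENNReal.ofReal_pos.2 (by linarith)) (by simp) hright
  refine le_trans (le_of_eq ?_) (measure_mono hsub)
  rw [measure_union _ measurableSet_Ioo, Real.volume_Ioo, Real.volume_Ioo,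
    ← ENNReal.ofReal_add (by linarith) (by linarith)]
  · congr 1
    ring
  · exact Set.disjoint_left.2 fun x h1 h2 => lt_asymm h1.2 h2.1

/-- A uniform bound on the measures of finite unions of a family of open intervals bounds the
measure of the whole union. -/
lemma measure_biUnion_Ioo_le_of_finset (μ : Measure ℝ) (C : Set (ℝ × ℝ)) {B : ℝ≥0∞}
    (h : ∀ S : Finset (ℝ × ℝ), ↑S ⊆ C → μ (⋃ q ∈ S, Ioo q.1 q.2) ≤ B) :
    μ (⋃ q ∈ C, Ioo q.1 q.2) ≤ B := by
  classical
  obtain ⟨T, hTC, hT, hTU⟩ := TopologicalSpace.isOpen_biUnion_countable C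
    (fun q : ℝ × ℝ => Ioo q.1 q.2) fun q _ => isOpen_Ioo
  rw [← hTU]
  rcases T.eq_empty_or_nonempty with rfl | hne
  · simp
  obtain ⟨u, rfl⟩ := hT.exists_eq_range hne
  rw [biUnion_range, measure_iUnion_eq_iSup_accumulate]
  refine iSup_le fun n => ?_
  refine le_trans (le_of_eq ?_) (h ((Finset.range (n + 1)).image u) ?_)
  · congr 1
    simp [accumulate_def]
  · intro q hq
    simp only [Finset.coe_image, mem_image] at hq
    obtain ⟨i, -, rfl⟩ := hq
    exact hTC (mem_range_self i)

lemma setOf_lt_maximalE_eq_biUnion (μ : Measure ℝ) (g : ℝ → ℝ≥0∞) (c : ℝ≥0∞) :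
    {x | c < maximalE μ g x} = ⋃ q ∈ {q : ℝ × ℝ | 0 < μ (Ioo q.1 q.2) ∧
      c < (μ (Ioo q.1 q.2))⁻¹ * ∫⁻ y in Ioo q.1 q.2, g y ∂μ}, Ioo q.1 q.2 := by
  ext x
  simp only [maximalE, lt_iSup_iff, mem_ofPred_eq, mem_iUnion, exists_prop, Prod.exists]
  exact ⟨fun ⟨a, b, h1, h2, h3⟩ => ⟨a, b, ⟨h2, h3⟩, h1⟩,
    fun ⟨a, b, ⟨h2, h3⟩, h1⟩ => ⟨a, b, h1, h2, h3⟩⟩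

/-- `‖M_μ f‖_{L^{p,∞}(dμ)} ≤ ‖M(f*)‖_{L^{p,∞}(dx)}`. -/
theorem stmt_17 (p : ℝ) (hp : 1 < p) (μ : Measure ℝ) (f : ℝ → ℝ) (hf : Measurable f)
    (hf0 : ∀ x, 0 ≤ f x)
    (hfin : ∀ t : ℝ, 0 < t → μ {x | t < f x} < ⊤) :
    wnormE μ (maximal μ f) p ≤ wnormE volume (maximalE volume (rearr μ f)) p := by
  have habs : (fun y => ENNReal.ofReal |f y|) = fun y => ENNReal.ofReal (f y) :=
    funext fun y => by rw [abs_of_nonneg (hf0 y)]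
  have hmax : maximal μ f = maximalE μ fun y => ENNReal.ofReal (f y) := by
    funext x
    rw [maximal, habs]
  have hrearr : rearr μ f = rearrE μ fun y => ENNReal.ofReal (f y) := by
    funext x
    rw [rearr, habs]
  rw [hmax, hrearr]
  refine iSup₂_le fun c hc => ?_
  have hbound : μ {x | ENNReal.ofReal c < maximalE μ (fun y => ENNReal.ofReal (f y)) x} ≤
      volume {x | ENNReal.ofReal c ≤
        maximalE volume (rearrE μ fun y => ENNReal.ofReal (f y)) x} := by
    rw [setOf_lt_maximalE_eq_biUnion]
    refine measure_biUnion_Ioo_le_of_finset μ _ fun S hSC => ?_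
    have hSfin : ∀ q ∈ S, μ (Ioo q.1 q.2) ≠ ∞ := by
      intro q hq htop
      have := (hSC hq).2
      simp [htop] at this
    refine measure_biUnion_le_volume_maximalE_rearrE μ hf hf0 hfin hc S hSfin fun q hq => ?_
    obtain ⟨hpos, hlt⟩ := hSC hq
    rw [mul_comm, ← div_eq_mul_inv] at hlt
    exact (ENNReal.le_div_iff_mul_le (.inl hpos.ne') (.inl (hSfin q hq))).1 hlt.le
  refine ENNReal.mul_le_of_forall_lt fun c' hc' b' hb' => ?_
  rcases eq_or_ne c' 0 with rfl | hc0
  · simp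
  have hctop : c' ≠ ∞ := (hc'.trans ENNReal.ofReal_lt_top).ne
  refine le_trans ?_ (le_iSup₂_of_le c'.toReal (ENNReal.toReal_pos hc0 hctop) le_rfl)
  rw [ENNReal.ofReal_toReal hctop]
  refine mul_le_mul_right (hb'.le.trans (ENNReal.rpow_le_rpow ?_ (by positivity))) _
  exact hbound.trans (measure_mono fun x hx => hc'.trans_le hx)
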